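/- Let K ≥ 1 and F = S_K the Simes function. Then for every ε ∈ (0,1): a_F(ε) = ε/ℓ_K, b_F(ε) = ε, and c_F(ε) = ε. Consequently b_F(ε)/a_F(ε) = c_F(ε)/a_F(ε) = ℓ_K, and ℓ_K/log K → 1 as K → ∞. -/

import Mathlib

open MeasureTheory ProbabilityTheory Real Set Filter

/-- The uniform probability measure on `[0,1]` (Lebesgue measure restricted to `[0,1]`). -/
noncomputable def unif01 : MeasureTheory.Measure ℝ :=
  MeasureTheory.volume.restrict (Set.Icc (0:ℝ) 1)

instance : MeasureTheory.IsProbabilityMeasure unif01 := by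
  constructor
  simp [unif01, Real.volume_Icc]

/-- `U` is uniformly distributed on `[0,1]` under `P`. -/
def IsUnif {Ω : Type*} [MeasurableSpace Ω] (P : MeasureTheory.Measure Ω) (U : Ω → ℝ) : Prop :=
  Measurable U ∧ MeasureTheory.Measure.map U P = unif01

/-- Left `ε`-quantile of a random variable `X` under `P`:
`q_ε(X) = inf {x : ε ≤ P(X ≤ x)}`. -/
noncomputable def lQuantile {Ω : Type*} [MeasurableSpace Ω] (P : MeasureTheory.Measure Ω)
    (X : Ω → ℝ) (ε : ℝ) : ℝ :=
  sInf {x : ℝ | ε ≤ (P {ω | X ω ≤ x}).toReal}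

/-- The measure `P` is atomless: every non-null measurable set has a measurable subset of
different, nonzero measure. -/
def Atomless {Ω : Type*} [MeasurableSpace Ω] (P : MeasureTheory.Measure Ω) : Prop :=
  ∀ A, MeasurableSet A → P A ≠ 0 →
    ∃ B, B ⊆ A ∧ MeasurableSet B ∧ P B ≠ 0 ∧ P B ≠ P A

/-- VAD threshold: infimum of left `ε`-quantiles of `F(U_1,…,U_K)` over all
uniformly distributed `U_1,…,U_K` on `[0,1]` with arbitrary joint dependence. -/
noncomputable def VAD {Ω : Type*} [MeasurableSpace Ω] (P : MeasureTheory.Measure Ω) (K : ℕ)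
    (F : (Fin K → ℝ) → ℝ) (ε : ℝ) : ℝ :=
  sInf {y : ℝ | ∃ U : Fin K → Ω → ℝ, (∀ i, IsUnif P (U i)) ∧
    y = lQuantile P (fun ω => F (fun i => U i ω)) ε}

/-- VI threshold: left `ε`-quantile of `F(V_1,…,V_K)` for independent uniforms,
realized via the product measure. -/
noncomputable def VI (K : ℕ) (F : (Fin K → ℝ) → ℝ) (ε : ℝ) : ℝ :=
  lQuantile (MeasureTheory.Measure.pi fun _ : Fin K => unif01) F ε

/-- VC threshold: left `ε`-quantile of `F(U,…,U)` for a single uniform `U`. -/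
noncomputable def VC (K : ℕ) (F : (Fin K → ℝ) → ℝ) (ε : ℝ) : ℝ :=
  lQuantile unif01 (fun u => F (fun _ => u)) ε

/-- Simes combining function `S_K(p) = min_i K·p_{(i)}/i`, where
`p_{(i)} = p (Tuple.sort p i)` is the `(i+1)`-th smallest order statistic. -/
noncomputable def simes (K : ℕ) (p : Fin K → ℝ) : ℝ :=
  sInf {y : ℝ | ∃ i : Fin K, y = (K : ℝ) * p (Tuple.sort p i) / ((i : ℕ) + 1)}

/-- `ℓ_K = Σ_{k=1}^K 1/k`. -/
noncomputable def ellK (K : ℕ) : ℝ := ∑ k ∈ Finset.range K, ((k : ℝ) + 1)⁻¹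

/-- In an atomless probability space there is an increasing family of events indexed by their
probabilities. It is extracted from a maximal chain for the relation `A ⊆ B ∧ P A < P B`. -/
lemma Atomless.exists_monotone_family {Ω : Type*} [MeasurableSpace Ω]
    {P : MeasureTheory.Measure Ω} [IsProbabilityMeasure P] (hP : Atomless P) :
    ∃ E : unitInterval → Set Ω, (∀ s, MeasurableSet (E s)) ∧ Monotone E ∧
      ∀ s, P (E s) = ENNReal.ofReal s := by
  let r : {E : Set Ω // MeasurableSet E} → {E : Set Ω // MeasurableSet E} → Prop :=
    fun E F => E.1 ⊆ F.1 ∧ P E.1 < P F.1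
  obtain ⟨C, hC⟩ : ∃ C, IsMaxChain r C := ⟨maxChain r, maxChain_spec⟩
  have hmax : ∀ X, ∃ E ∈ C, ¬ r X E ∧ ¬ r E X := by
    intro X
    by_contra! h
    have hX : X ∈ C := by
      rw [hC.2 (hC.1.insert fun b hb _ => or_iff_not_imp_left.2 (h b hb)) (subset_insert X C)]
      exact mem_insert _ _
    have hXX : ¬ r X X := fun h => lt_irrefl _ h.2
    exact hXX (h X hX hXX)
  have tot : ∀ E ∈ C, ∀ F ∈ C, P E.1 ≤ P F.1 → E.1 ⊆ F.1 := by
    intro E hE F hF hEF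
    by_cases h : E = F
    · rw [h]
    · rcases hC.1 hE hF h with h | h
      · exact h.1
      · exact absurd h.2 hEF.not_gt
  have hsup : ∀ u : ℕ → {E : Set Ω // MeasurableSet E}, (∀ n, u n ∈ C) →
      ∃ E ∈ C, P E.1 = ⨆ n, P (u n).1 := by
    intro u hu
    have hdir : Directed (· ⊆ ·) fun n => (u n).1 := by
      intro m n
      rcases le_total (P (u m).1) (P (u n).1) with h | h
      · exact ⟨n, tot _ (hu m) _ (hu n) h, subset_rfl⟩
      · exact ⟨m, subset_rfl, tot _ (hu n) _ (hu m) h⟩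
    obtain ⟨E, hE, h1, h2⟩ := hmax ⟨⋃ n, (u n).1, MeasurableSet.iUnion fun n => (u n).2⟩
    refine ⟨E, hE, ?_⟩
    simp only [r, hdir.measure_iUnion] at h1 h2
    rcases lt_trichotomy (P E.1) (⨆ n, P (u n).1) with h | h | h
    · obtain ⟨n, hn⟩ := lt_iSup_iff.1 h
      exact absurd ⟨(tot _ hE _ (hu n) hn.le).trans (subset_iUnion (fun n => (u n).1) n), h⟩ h2
    · exact h
    · exact absurd ⟨iUnion_subset fun n => tot _ (hu n) _ hE
        ((le_iSup (fun n => P (u n).1) n).trans h.le), h⟩ h1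
  have hinf : ∀ u : ℕ → {E : Set Ω // MeasurableSet E}, (∀ n, u n ∈ C) →
      ∃ E ∈ C, P E.1 = ⨅ n, P (u n).1 := by
    intro u hu
    have hdir : Directed (· ⊇ ·) fun n => (u n).1 := by
      intro m n
      rcases le_total (P (u m).1) (P (u n).1) with h | h
      · exact ⟨m, subset_rfl, tot _ (hu m) _ (hu n) h⟩
      · exact ⟨n, tot _ (hu n) _ (hu m) h, subset_rfl⟩
    have hm := hdir.measure_iInter (μ := P) (fun n => (u n).2.nullMeasurableSet)
      ⟨0, measure_ne_top _ _⟩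
    obtain ⟨E, hE, h1, h2⟩ := hmax ⟨⋂ n, (u n).1, MeasurableSet.iInter fun n => (u n).2⟩
    refine ⟨E, hE, ?_⟩
    simp only [r, hm] at h1 h2
    rcases lt_trichotomy (P E.1) (⨅ n, P (u n).1) with h | h | h
    · exact absurd ⟨subset_iInter fun n => tot _ hE _ (hu n)
        (h.le.trans (iInf_le (fun n => P (u n).1) n)), h⟩ h2
    · exact h
    · obtain ⟨n, hn⟩ := iInf_lt_iff.1 h
      exact absurd ⟨(iInter_subset (fun n => (u n).1) n).trans (tot _ (hu n) _ hE hn.le), h⟩ h1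
  have hex : ∀ s : ENNReal, s ≤ 1 → ∃ E ∈ C, P E.1 = s := by
    intro s hs
    by_contra! hne
    have hL : ((fun E : {E : Set Ω // MeasurableSet E} => P E.1) '' {E ∈ C | P E.1 ≤ s}).Nonempty := by
      obtain ⟨E, hE, h1, -⟩ := hmax ⟨∅, MeasurableSet.empty⟩
      refine ⟨_, E, ⟨hE, ?_⟩, rfl⟩
      have : P E.1 = 0 := by simpa [r] using h1
      simp [this]
    have hR : ((fun E : {E : Set Ω // MeasurableSet E} => P E.1) '' {E ∈ C | s ≤ P E.1}).Nonempty := by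
      obtain ⟨E, hE, -, h1⟩ := hmax ⟨univ, MeasurableSet.univ⟩
      refine ⟨_, E, ⟨hE, ?_⟩, rfl⟩
      refine hs.trans (not_lt.1 fun h => h1 ⟨subset_univ _, ?_⟩)
      rwa [measure_univ]
    obtain ⟨u, hum, hut, hu⟩ := exists_seq_tendsto_sSup hL (OrderTop.bddAbove _)
    obtain ⟨v, hvm, hvt, hv⟩ := exists_seq_tendsto_sInf hR (OrderBot.bddBelow _)
    have hu' := tendsto_nhds_unique hut (tendsto_atTop_iSup hum)
    have hv' := tendsto_nhds_unique hvt (tendsto_atTop_iInf hvm)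
    choose u' hu1 hu2 using hu
    choose v' hv1 hv2 using hv
    obtain ⟨A, hA, hAe⟩ := hsup u' fun n => (hu1 n).1
    obtain ⟨B, hB, hBe⟩ := hinf v' fun n => (hv1 n).1
    simp only at hu2 hv2
    simp only [hu2, ← hu'] at hAe
    simp only [hv2, ← hv'] at hBe
    have hAs : P A.1 ≤ s := by
      rw [hAe]
      apply sSup_le
      rintro _ ⟨E, hE, rfl⟩
      exact hE.2
    have hBs : s ≤ P B.1 := by
      rw [hBe]
      apply le_sInf
      rintro _ ⟨E, hE, rfl⟩
      exact hE.2
    have hAB : P A.1 < P B.1 :=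
      (lt_of_le_of_ne hAs (hne A hA)).trans_le hBs
    have hsub : A.1 ⊆ B.1 := tot A hA B hB hAB.le
    obtain ⟨G, hG, hGm, hG0, hGne⟩ := hP (B.1 \ A.1) (B.2.diff A.2) (by
      rw [measure_sdiff hsub A.2.nullMeasurableSet (measure_ne_top _ _)]
      exact (tsub_pos_of_lt hAB).ne')
    have hdisj : Disjoint A.1 G := (disjoint_sdiff_right).mono_right hG
    have hX : P (A.1 ∪ G) = P A.1 + P G := measure_union hdisj hGm
    have hAX : P A.1 < P (A.1 ∪ G) := by
      rw [hX]
      exact ENNReal.lt_add_right (measure_ne_top _ _) hG0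
    have hXB : P (A.1 ∪ G) < P B.1 := by
      have : P B.1 = P A.1 + P (B.1 \ A.1) := by
        rw [← measure_union disjoint_sdiff_right (B.2.diff A.2), union_sdiff_cancel hsub]
      rw [hX, this]
      exact ENNReal.add_lt_add_left (measure_ne_top _ _)
        (lt_of_le_of_ne (measure_mono hG) hGne)
    obtain ⟨E, hE, h1, h2⟩ := hmax ⟨A.1 ∪ G, A.2.union hGm⟩
    rcases le_total (P E.1) s with h | h
    · have hEA : P E.1 ≤ P A.1 := by
        rw [hAe]
        exact le_sSup ⟨E, ⟨hE, h⟩, rfl⟩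
      exact h2 ⟨(tot E hE A hA hEA).trans subset_union_left, hEA.trans_lt hAX⟩
    · have hBE : P B.1 ≤ P E.1 := by
        rw [hBe]
        exact sInf_le ⟨E, ⟨hE, h⟩, rfl⟩
      exact h1 ⟨(union_subset hsub (hG.trans sdiff_subset)).trans (tot B hB E hE hBE),
        hXB.trans_le hBE⟩
  choose E hE hPE using fun s : unitInterval =>
    hex (ENNReal.ofReal s) (ENNReal.ofReal_le_one.2 s.2.2)
  refine ⟨fun s => (E s).1, fun s => (E s).2, fun s t hst => ?_, hPE⟩
  refine tot _ (hE s) _ (hE t) ?_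
  rw [hPE, hPE]
  exact ENNReal.ofReal_le_ofReal hst

lemma Atomless.exists_map_eq_volume {Ω : Type*} [MeasurableSpace Ω]
    {P : MeasureTheory.Measure Ω} [IsProbabilityMeasure P] (hP : Atomless P) :
    ∃ U : Ω → unitInterval, Measurable U ∧ P.map U = volume := by
  obtain ⟨E, hEm, hmono, hPE⟩ := hP.exists_monotone_family
  let U : Ω → unitInterval := fun ω => sInf {s | ω ∈ E s}
  have hU : ∀ ω t, U ω < t ↔ ∃ s, ω ∈ E s ∧ s < t := fun ω t => sInf_lt_iff
  obtain ⟨D, hDc, hDd⟩ := TopologicalSpace.exists_countable_dense unitInterval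
  have hUm : Measurable U := by
    refine measurable_of_Iio fun t => ?_
    have : U ⁻¹' Iio t = ⋃ s ∈ D ∩ Iio t, E s := by
      ext ω
      simp only [mem_preimage, mem_Iio, hU, mem_iUnion, mem_inter_iff, exists_prop]
      constructor
      · rintro ⟨s, hs, hst⟩
        obtain ⟨d, hd, hsd, hdt⟩ := hDd.exists_between hst
        exact ⟨d, ⟨hd, hdt⟩, hmono hsd.le hs⟩
      · rintro ⟨s, ⟨-, hst⟩, hs⟩
        exact ⟨s, hs, hst⟩
    rw [this]
    exact MeasurableSet.biUnion (hDc.mono inter_subset_left) fun s _ => hEm s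
  have hlt : ∀ t, P (U ⁻¹' Iio t) = ENNReal.ofReal t := by
    intro t
    apply le_antisymm
    · rw [← hPE t]
      refine measure_mono fun ω hω => ?_
      obtain ⟨s, hs, hst⟩ := (hU ω t).1 hω
      exact hmono hst.le hs
    · refine le_of_forall_lt fun c hc => ?_
      have hct : c ≠ ⊤ := hc.ne_top
      obtain ⟨d, hcd, hdt⟩ := exists_between ((ENNReal.lt_ofReal_iff_toReal_lt hct).1 hc)
      have hd0 : 0 ≤ d := ENNReal.toReal_nonneg.trans hcd.le
      calc c < ENNReal.ofReal d := (ENNReal.lt_ofReal_iff_toReal_lt hct).2 hcd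
        _ = P (E ⟨d, hd0, hdt.le.trans t.2.2⟩) := (hPE ⟨d, hd0, hdt.le.trans t.2.2⟩).symm
        _ ≤ P (U ⁻¹' Iio t) := measure_mono fun ω hω => (hU ω t).2 ⟨_, hω, hdt⟩
  refine ⟨U, hUm, ?_⟩
  have : IsProbabilityMeasure (P.map U) := Measure.isProbabilityMeasure_map hUm.aemeasurable
  refine Measure.ext_of_Ici _ _ fun t => ?_
  rw [← compl_Iio, prob_compl_eq_one_sub measurableSet_Iio, prob_compl_eq_one_sub measurableSet_Iio,
    Measure.map_apply hUm measurableSet_Iio, hlt, unitInterval.volume_Iio]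

/-- Every law on a standard Borel space is realized on an atomless probability space. -/
lemma Atomless.exists_map_eq {Ω α : Type*} [MeasurableSpace Ω] [MeasurableSpace α]
    [StandardBorelSpace α] [Nonempty α] {P : MeasureTheory.Measure Ω} [IsProbabilityMeasure P]
    (hP : Atomless P) (μ : MeasureTheory.Measure α) [IsProbabilityMeasure μ] :
    ∃ X : Ω → α, Measurable X ∧ P.map X = μ := by
  obtain ⟨U, hU, hPU⟩ := hP.exists_map_eq_volume
  obtain ⟨f, hf, hfμ⟩ := Measure.exists_measurable_map_eq μ
  exact ⟨f ∘ U, hf.comp hU, by rw [← Measure.map_map hf hU, hPU, hfμ]⟩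

lemma unif01_real_Iic {t : ℝ} (ht0 : 0 ≤ t) (ht1 : t ≤ 1) : unif01.real (Iic t) = t := by
  have : Iic t ∩ Icc (0 : ℝ) 1 = Icc 0 t := by
    ext u
    simp only [mem_inter_iff, mem_Iic, mem_Icc]
    grind
  rw [measureReal_def, unif01, Measure.restrict_apply measurableSet_Iic, this, Real.volume_Icc,
    sub_zero, ENNReal.toReal_ofReal ht0]

lemma unif01_real_Iic_le {t : ℝ} (ht0 : 0 ≤ t) : unif01.real (Iic t) ≤ t := by
  rcases le_total t 1 with h | h
  · exact (unif01_real_Iic ht0 h).le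
  · exact measureReal_le_one.trans h

/-- A random variable whose distribution function is the identity on `(0,1)` has identity
quantile function there. -/
lemma lQuantile_eq_self {Ω : Type*} [MeasurableSpace Ω] {P : MeasureTheory.Measure Ω}
    [IsFiniteMeasure P] {X : Ω → ℝ} (hX : ∀ x ∈ Ioo (0 : ℝ) 1, P.real {ω | X ω ≤ x} = x)
    {ε : ℝ} (hε : ε ∈ Ioo (0 : ℝ) 1) : lQuantile P X ε = ε := by
  refine IsLeast.csInf_eq ⟨(hX ε hε).ge, fun y hy => ?_⟩
  by_contra! h
  have hz : max y (ε / 2) ∈ Ioo (0 : ℝ) 1 :=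
    ⟨lt_max_of_lt_right (half_pos hε.1), max_lt (h.trans hε.2) (by linarith [hε.1, hε.2])⟩
  have h1 : P.real {ω | X ω ≤ y} ≤ P.real {ω | X ω ≤ max y (ε / 2)} :=
    measureReal_mono fun ω (hω : X ω ≤ y) => le_max_of_le_left hω
  rw [hX _ hz] at h1
  have h2 : ε ≤ P.real {ω | X ω ≤ y} := hy
  have h3 : max y (ε / 2) < ε := max_lt h (half_lt_self hε.1)
  linarith

lemma simes_le_iff {K : ℕ} (hK : 1 ≤ K) (p : Fin K → ℝ) (x : ℝ) :
    simes K p ≤ x ↔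
      ∃ r ∈ Finset.Icc 1 K, r ≤ (Finset.univ.filter fun i => p i ≤ r * x / K).card := by
  have hK0 : (0 : ℝ) < K := by exact_mod_cast hK
  have : Nonempty (Fin K) := ⟨⟨0, hK⟩⟩
  have hs : simes K p = sInf (range fun i : Fin K =>
      (K : ℝ) * p (Tuple.sort p i) / ((i : ℕ) + 1)) := by
    simp only [simes, range, eq_comm]
  have hmin : simes K p ≤ x ↔
      ∃ i : Fin K, (K : ℝ) * p (Tuple.sort p i) / ((i : ℕ) + 1) ≤ x := by
    rw [hs]
    constructor
    · intro h
      obtain ⟨i, hi⟩ := (range_nonempty _).csInf_mem (finite_range fun i : Fin K =>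
        (K : ℝ) * p (Tuple.sort p i) / ((i : ℕ) + 1))
      exact ⟨i, hi.trans_le h⟩
    · rintro ⟨i, hi⟩
      exact (csInf_le (finite_range _).bddBelow ⟨i, rfl⟩).trans hi
  have hcard : ∀ (i : Fin K) (t : ℝ), p (Tuple.sort p i) ≤ t ↔
      (i : ℕ) < (Finset.univ.filter fun j => p j ≤ t).card := by
    intro i t
    have h1 := Tuple.lt_card_le_iff_apply_le_of_monotone (j := i) (a := t)
      (Tuple.monotone_sort p)
    have h2 : (Finset.univ.filter fun j => (p ∘ Tuple.sort p) j ≤ t).card =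
        (Finset.univ.filter fun j => p j ≤ t).card :=
      Finset.card_equiv (Tuple.sort p) (by simp)
    rw [← h2]
    exact h1.symm
  have key : ∀ i : Fin K, (K : ℝ) * p (Tuple.sort p i) / ((i : ℕ) + 1) ≤ x ↔
      p (Tuple.sort p i) ≤ ((i + 1 : ℕ) : ℝ) * x / K := by
    intro i
    rw [div_le_iff₀ (by positivity), le_div_iff₀ hK0]
    push_cast
    rw [mul_comm (K : ℝ), mul_comm x]
  rw [hmin]
  constructor
  · rintro ⟨i, hi⟩
    exact ⟨i + 1, Finset.mem_Icc.2 ⟨by omega, i.2⟩, (hcard _ _).1 ((key i).1 hi)⟩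
  · rintro ⟨r, hr, h⟩
    obtain ⟨h1, h2⟩ := Finset.mem_Icc.1 hr
    refine ⟨⟨r - 1, by omega⟩, (key _).2 ((hcard _ _).2 ?_)⟩
    simp only [Nat.sub_add_cancel h1]
    omega

lemma measurableSet_le_card_filter {ι : Type*} [Fintype ι] (r : ℕ) (t : ℝ) :
    MeasurableSet {p : ι → ℝ | r ≤ (Finset.univ.filter fun i => p i ≤ t).card} := by
  have : Measurable fun p : ι → ℝ => (Finset.univ.filter fun i => p i ≤ t).card := by
    simp only [Finset.card_filter]
    refine Finset.measurable_sum _ fun i _ => Measurable.ite ?_ measurable_const measurable_const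
    exact measurableSet_le (measurable_pi_apply i) measurable_const
  exact this measurableSet_Ici

lemma measurableSet_simes_le {K : ℕ} (hK : 1 ≤ K) (x : ℝ) :
    MeasurableSet {p | simes K p ≤ x} := by
  have : {p | simes K p ≤ x} = ⋃ r ∈ Finset.Icc 1 K,
      {p : Fin K → ℝ | r ≤ (Finset.univ.filter fun i => p i ≤ r * x / K).card} := by
    ext p
    simp only [mem_ofPred_eq, simes_le_iff hK, mem_iUnion, exists_prop]
  rw [this]
  exact Finset.measurableSet_biUnion _ fun r _ => measurableSet_le_card_filter _ _

lemma simes_const_le_iff {K : ℕ} (hK : 1 ≤ K) {u x : ℝ} (hx : 0 ≤ x) :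
    simes K (fun _ => u) ≤ x ↔ u ≤ x := by
  have hK0 : (0 : ℝ) < K := by exact_mod_cast hK
  rw [simes_le_iff hK]
  constructor
  · rintro ⟨r, hr, h⟩
    obtain ⟨h1, h2⟩ := Finset.mem_Icc.1 hr
    obtain ⟨i, hi⟩ := Finset.card_pos.1 (h1.trans h)
    have hi' := (Finset.mem_filter.1 hi).2
    refine hi'.trans ?_
    rw [div_le_iff₀ hK0, mul_comm]
    have : (r : ℝ) ≤ K := by exact_mod_cast h2
    gcongr
  · intro h
    refine ⟨K, Finset.mem_Icc.2 ⟨hK, le_rfl⟩, ?_⟩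
    have : u ≤ K * x / K := by rwa [mul_div_cancel_left₀ _ hK0.ne']
    simp [this]

lemma VC_simes {K : ℕ} (hK : 1 ≤ K) {ε : ℝ} (hε : ε ∈ Ioo (0 : ℝ) 1) :
    VC K (simes K) ε = ε := by
  refine lQuantile_eq_self (fun x hx => ?_) hε
  simp only [simes_const_le_iff hK hx.1.le]
  exact unif01_real_Iic hx.1.le hx.2.le

/-- `r` is the last index at which the order statistics of `p` lie below the Simes line of
level `x` (with `r = 0` if there is none). -/
def IsSimesRank {K : ℕ} (x : ℝ) (r : ℕ) (p : Fin K → ℝ) : Prop :=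
  r ≤ (Finset.univ.filter fun i => p i ≤ r * x / K).card ∧
    ∀ s ∈ Finset.Ioc r K, (Finset.univ.filter fun i => p i ≤ s * x / K).card < s

namespace IsSimesRank

variable {K : ℕ} {x : ℝ} {r s : ℕ} {p q : Fin K → ℝ}

lemma measurableSet (x : ℝ) (r : ℕ) : MeasurableSet {p : Fin K → ℝ | IsSimesRank x r p} := by
  have : {p : Fin K → ℝ | IsSimesRank x r p} =
      {p : Fin K → ℝ | r ≤ (Finset.univ.filter fun i => p i ≤ r * x / K).card} ∩
      ⋂ s ∈ Finset.Ioc r K,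
        {p : Fin K → ℝ | s ≤ (Finset.univ.filter fun i => p i ≤ s * x / K).card}ᶜ := by
    ext p
    simp only [IsSimesRank, mem_ofPred_eq, mem_inter_iff, mem_iInter, mem_compl_iff, not_le]
  rw [this]
  exact (measurableSet_le_card_filter _ _).inter
    (Finset.measurableSet_biInter _ fun s _ => (measurableSet_le_card_filter _ _).compl)

lemma unique (hr : r ≤ K) (hs : s ≤ K) (h : IsSimesRank x r p) (h' : IsSimesRank x s p) :
    r = s := by
  rcases lt_trichotomy r s with hlt | heq | hlt
  · exact absurd h'.1 (h.2 s (Finset.mem_Ioc.2 ⟨hlt, hs⟩)).not_ge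
  · exact heq
  · exact absurd h.1 (h'.2 r (Finset.mem_Ioc.2 ⟨hlt, hr⟩)).not_ge

lemma exists_iff : (∃ r ∈ Finset.Icc 1 K, IsSimesRank x r p) ↔
    ∃ r ∈ Finset.Icc 1 K, r ≤ (Finset.univ.filter fun i => p i ≤ r * x / K).card := by
  constructor
  · rintro ⟨r, hr, h⟩
    exact ⟨r, hr, h.1⟩
  · rintro ⟨r, hr, h⟩
    obtain ⟨m, hm, hmax⟩ := ((Finset.Icc 1 K).filter fun r : ℕ =>
      r ≤ (Finset.univ.filter fun i => p i ≤ r * x / K).card).exists_max_image id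
      ⟨r, Finset.mem_filter.2 ⟨hr, h⟩⟩
    obtain ⟨hm1, hm2⟩ := Finset.mem_filter.1 hm
    refine ⟨m, hm1, hm2, fun s hs => ?_⟩
    by_contra! hle
    rw [Finset.mem_Ioc] at hs
    exact absurd (hmax s (Finset.mem_filter.2 ⟨Finset.mem_Icc.2 ⟨by omega, hs.2⟩, hle⟩))
      (not_le.2 hs.1)

lemma card_eq (hx : 0 ≤ x) (hr : r ≤ K) (h : IsSimesRank x r p) :
    (Finset.univ.filter fun i => p i ≤ r * x / K).card = r := by
  refine le_antisymm ?_ h.1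
  rcases hr.lt_or_eq with hlt | rfl
  · have h1 := h.2 (r + 1) (Finset.mem_Ioc.2 ⟨by omega, hlt⟩)
    have h2 : (Finset.univ.filter fun i => p i ≤ r * x / K).card ≤
        (Finset.univ.filter fun i => p i ≤ (r + 1 : ℕ) * x / K).card := by
      refine Finset.card_le_card fun i hi => ?_
      simp only [Finset.mem_filter, Finset.mem_univ, true_and] at hi ⊢
      refine hi.trans ?_
      gcongr
      simp
    omega
  · exact (Finset.card_filter_le _ _).trans (by simp)

lemma congr_of_le (h : ∀ s, r ≤ s → ∀ i, p i ≤ s * x / K ↔ q i ≤ s * x / K) :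
    IsSimesRank x r p ↔ IsSimesRank x r q := by
  have hc : ∀ s, r ≤ s → (Finset.univ.filter fun i => p i ≤ s * x / K) =
      Finset.univ.filter fun i => q i ≤ s * x / K :=
    fun s hs => Finset.filter_congr fun i _ => h s hs i
  unfold IsSimesRank
  rw [hc r le_rfl]
  refine and_congr_right fun _ => forall₂_congr fun s hs => ?_
  rw [hc s (Finset.mem_Ioc.1 hs).1.le]

lemma insertNth_iff {n : ℕ} {x : ℝ} (hx : 0 ≤ x) {r : ℕ} {i : Fin (n + 1)} {u : ℝ}
    (hu : u ≤ r * x / (n + 1 : ℕ)) (q : Fin n → ℝ) :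
    IsSimesRank x r (i.insertNth (α := fun _ => ℝ) u q) ↔
      IsSimesRank x r (i.insertNth (α := fun _ => ℝ) 0 q) := by
  refine congr_of_le fun s hs j => ?_
  refine Fin.succAboveCases i ?_ (fun k => ?_) j
  · simp only [Fin.insertNth_apply_same]
    have h0 : 0 ≤ s * x / (n + 1 : ℕ) := by positivity
    have h1 : u ≤ s * x / (n + 1 : ℕ) := hu.trans (by gcongr)
    exact iff_of_true h1 h0
  · simp only [Fin.insertNth_apply_succAbove]

lemma exists_insertNth_zero {n : ℕ} {x : ℝ} (hx : 0 ≤ x) (i : Fin (n + 1)) (q : Fin n → ℝ) :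
    ∃ r ∈ Finset.Icc 1 (n + 1), IsSimesRank x r (i.insertNth (α := fun _ => ℝ) 0 q) := by
  refine exists_iff.2 ⟨1, by simp, Finset.card_pos.2 ⟨i, ?_⟩⟩
  simp only [Finset.mem_filter, Finset.mem_univ, true_and, Fin.insertNth_apply_same]
  positivity

end IsSimesRank

lemma pi_unif01_real_inter {n : ℕ} {x : ℝ} (hx0 : 0 ≤ x) (hx1 : x ≤ 1) {r : ℕ} (hr : r ≤ n + 1)
    (i : Fin (n + 1)) :
    (Measure.pi fun _ : Fin (n + 1) => unif01).real
        ({p | IsSimesRank x r p} ∩ {p | p i ≤ r * x / (n + 1 : ℕ)}) =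
      r * x / (n + 1 : ℕ) * (Measure.pi fun _ : Fin n => unif01).real
        {q | IsSimesRank x r (i.insertNth (α := fun _ => ℝ) 0 q)} := by
  have hmp := measurePreserving_piFinSuccAbove (fun _ : Fin (n + 1) => unif01) i
  have hpre : {p | IsSimesRank x r p} ∩ {p | p i ≤ r * x / (n + 1 : ℕ)} =
      MeasurableEquiv.piFinSuccAbove (fun _ => ℝ) i ⁻¹' (Iic (r * x / (n + 1 : ℕ)) ×ˢ
        {q | IsSimesRank x r (i.insertNth (α := fun _ => ℝ) 0 q)}) := by
    ext p
    rw [inter_comm]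
    simp only [mem_inter_iff, mem_ofPred_eq, mem_preimage, mem_prod, mem_Iic]
    refine and_congr_right fun hp => ?_
    have := IsSimesRank.insertNth_iff (i := i) hx0 hp (i.removeNth p)
    rwa [Fin.insertNth_self_removeNth] at this
  have ht : r * x / (n + 1 : ℕ) ≤ 1 := by
    rw [div_le_one (by positivity)]
    have : (r : ℝ) ≤ (n + 1 : ℕ) := by exact_mod_cast hr
    nlinarith
  rw [measureReal_def, hpre, hmp.measure_preimage_equiv, Measure.prod_prod, ENNReal.toReal_mul]
  congr 1
  exact unif01_real_Iic (by positivity) ht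

/-- Summing the measures of the sets `A ∩ {p | Q i p}` counts how many `Q i` hold on `A`. -/
lemma sum_measureReal_inter_of_card_eq {α ι : Type*} [MeasurableSpace α] [Fintype ι]
    {μ : MeasureTheory.Measure α} [IsFiniteMeasure μ] {A : Set α} (hA : MeasurableSet A)
    {Q : ι → α → Prop} [∀ a, DecidablePred fun i => Q i a] (hQ : ∀ i, MeasurableSet {a | Q i a})
    {r : ℕ} (hr : ∀ a ∈ A, (Finset.univ.filter fun i => Q i a).card = r) :
    ∑ i, μ.real (A ∩ {a | Q i a}) = r * μ.real A := by
  classical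
  have h1 : ∀ i, μ.real (A ∩ {a | Q i a}) = ∫ a in A, {a | Q i a}.indicator 1 a ∂μ := by
    intro i
    rw [integral_indicator_one (hQ i), measureReal_restrict_apply (hQ i), inter_comm]
  simp only [h1]
  rw [← integral_finsetSum]
  · rw [setIntegral_congr_fun (g := fun _ => (r : ℝ)) hA, setIntegral_const, smul_eq_mul, mul_comm]
    intro a ha
    simp only [← hr a ha, Finset.card_filter, indicator_apply, mem_ofPred_eq, Pi.one_apply]
    push_cast
    exact Finset.sum_congr rfl fun i _ => by congr
  · intro i _
    exact (integrable_const (1 : ℝ)).indicator (hQ i)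

/-- Simes' identity. -/
lemma pi_unif01_real_simes_le {K : ℕ} (hK : 1 ≤ K) {x : ℝ} (hx0 : 0 ≤ x) (hx1 : x ≤ 1) :
    (Measure.pi fun _ : Fin K => unif01).real {p | simes K p ≤ x} = x := by
  obtain ⟨n, rfl⟩ : ∃ n, K = n + 1 := ⟨K - 1, by omega⟩
  have hK0 : (0 : ℝ) < (n + 1 : ℕ) := by positivity
  have hset : {p | simes (n + 1) p ≤ x} =
      ⋃ r ∈ Finset.Icc 1 (n + 1), {p : Fin (n + 1) → ℝ | IsSimesRank x r p} := by
    ext p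
    simp only [mem_ofPred_eq, simes_le_iff hK, ← IsSimesRank.exists_iff, mem_iUnion, exists_prop]
  have hsum : ∀ i : Fin (n + 1), ∑ r ∈ Finset.Icc 1 (n + 1),
      (Measure.pi fun _ : Fin n => unif01).real
        {q | IsSimesRank x r (i.insertNth (α := fun _ => ℝ) 0 q)} = 1 := by
    intro i
    rw [← measureReal_biUnion_finset]
    · rw [show (⋃ r ∈ Finset.Icc 1 (n + 1),
          {q | IsSimesRank x r (i.insertNth (α := fun _ => ℝ) 0 q)}) = univ from ?_, probReal_univ]
      rw [eq_univ_iff_forall]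
      intro q
      simpa only [mem_iUnion, mem_ofPred_eq, exists_prop] using
        IsSimesRank.exists_insertNth_zero hx0 i q
    · intro r hr s hs hrs
      rw [Function.onFun, Set.disjoint_left]
      intro q h1 h2
      exact hrs (h1.unique (Finset.mem_Icc.1 hr).2 (Finset.mem_Icc.1 hs).2 h2)
    · intro r _
      have : Measurable fun q : Fin n → ℝ => i.insertNth (α := fun _ => ℝ) 0 q := by
        refine measurable_pi_lambda _ fun j => ?_
        refine Fin.succAboveCases i ?_ (fun k => ?_) j
        · simp only [Fin.insertNth_apply_same, measurable_const]
        · simp only [Fin.insertNth_apply_succAbove]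
          exact measurable_pi_apply k
      exact this (IsSimesRank.measurableSet x r)
  have hrank : ∀ r ∈ Finset.Icc 1 (n + 1),
      (Measure.pi fun _ : Fin (n + 1) => unif01).real {p | IsSimesRank x r p} =
        ∑ i : Fin (n + 1), x / (n + 1 : ℕ) * (Measure.pi fun _ : Fin n => unif01).real
          {q | IsSimesRank x r (i.insertNth (α := fun _ => ℝ) 0 q)} := by
    intro r hr
    obtain ⟨hr1, hr2⟩ := Finset.mem_Icc.1 hr
    have hr0 : (r : ℝ) ≠ 0 := by positivity
    have h := sum_measureReal_inter_of_card_eq (μ := Measure.pi fun _ : Fin (n + 1) => unif01)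
      (Q := fun i p => p i ≤ r * x / (n + 1 : ℕ)) (IsSimesRank.measurableSet x r)
      (fun i => measurableSet_le (measurable_pi_apply i) measurable_const)
      (fun p hp => hp.card_eq hx0 hr2)
    simp only [pi_unif01_real_inter hx0 hx1 hr2] at h
    rw [← mul_right_inj' hr0, ← h, Finset.mul_sum]
    exact Finset.sum_congr rfl fun i _ => by ring
  rw [hset, measureReal_biUnion_finset]
  · rw [Finset.sum_congr rfl hrank, Finset.sum_comm]
    simp only [← Finset.mul_sum, hsum]
    rw [Finset.sum_const, Finset.card_univ, Fintype.card_fin, nsmul_eq_mul, mul_one]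
    field_simp
  · intro r hr s hs hrs
    rw [Function.onFun, Set.disjoint_left]
    intro q h1 h2
    exact hrs (h1.unique (Finset.mem_Icc.1 hr).2 (Finset.mem_Icc.1 hs).2 h2)
  · exact fun r _ => IsSimesRank.measurableSet x r

lemma VI_simes {K : ℕ} (hK : 1 ≤ K) {ε : ℝ} (hε : ε ∈ Ioo (0 : ℝ) 1) :
    VI K (simes K) ε = ε :=
  lQuantile_eq_self (fun _ hx => pi_unif01_real_simes_le hK hx.1.le hx.2.le) hε

lemma sum_Ico_one_div_sub {m n : ℕ} (h : m ≤ n) :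
    ∑ j ∈ Finset.Ico m n, ((1 : ℝ) / (j + 1) - 1 / (j + 2)) = 1 / (m + 1) - 1 / (n + 1) := by
  induction n, h using Nat.le_induction with
  | base => simp
  | succ k hk ih =>
    rw [Finset.sum_Ico_succ_top hk, ih]
    push_cast
    ring

/-- A step function of one p-value which is at least `1 / r` when the p-value is at most
`r * x / (n + 1)`. -/
noncomputable def simesWeight (n : ℕ) (x p : ℝ) : ℝ :=
  ∑ j ∈ Finset.range n,
    ((1 : ℝ) / (j + 1) - 1 / (j + 2)) * (Iic ((j + 1) * x / (n + 1))).indicator 1 p +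
  1 / (n + 1) * (Iic x).indicator 1 p

lemma one_div_add_one_sub_nonneg (j : ℕ) : 0 ≤ (1 : ℝ) / (j + 1) - 1 / (j + 2) := by
  rw [sub_nonneg]
  gcongr
  norm_num

lemma simesWeight_nonneg (n : ℕ) (x p : ℝ) : 0 ≤ simesWeight n x p := by
  have h : ∀ y : ℝ, 0 ≤ (Iic y).indicator (1 : ℝ → ℝ) p :=
    fun y => indicator_nonneg (fun _ _ => zero_le_one) p
  exact add_nonneg (Finset.sum_nonneg fun j _ => mul_nonneg (one_div_add_one_sub_nonneg j) (h _))
    (mul_nonneg (by positivity) (h _))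

lemma one_div_le_simesWeight {n m : ℕ} (hm : m ≤ n) {x p : ℝ} (hx : 0 ≤ x)
    (hp : p ≤ (m + 1) * x / (n + 1)) : 1 / ((m : ℝ) + 1) ≤ simesWeight n x p := by
  have hm' : (m : ℝ) ≤ n := by exact_mod_cast hm
  have hpx : p ≤ x := by
    refine hp.trans ?_
    rw [div_le_iff₀ (by positivity), mul_comm]
    gcongr
  have h1 : ∑ j ∈ Finset.Ico m n, ((1 : ℝ) / (j + 1) - 1 / (j + 2)) ≤
      ∑ j ∈ Finset.range n,
        ((1 : ℝ) / (j + 1) - 1 / (j + 2)) * (Iic ((j + 1) * x / (n + 1))).indicator 1 p := by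
    rw [Finset.range_eq_Ico]
    refine (Finset.sum_le_sum fun j hj => ?_).trans
      (Finset.sum_le_sum_of_subset_of_nonneg (Finset.Ico_subset_Ico_left m.zero_le)
        fun j _ _ => mul_nonneg (one_div_add_one_sub_nonneg j)
          (indicator_nonneg (fun _ _ => zero_le_one) p))
    have hmj : (m : ℝ) ≤ j := by exact_mod_cast (Finset.mem_Ico.1 hj).1
    have : p ∈ Iic ((j + 1) * x / (n + 1) : ℝ) := hp.trans (by gcongr)
    simp [indicator_of_mem this]
  rw [sum_Ico_one_div_sub hm] at h1
  have h2 : (Iic x).indicator (1 : ℝ → ℝ) p = 1 := by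
    rw [indicator_of_mem (show p ∈ Iic x from hpx), Pi.one_apply]
  rw [simesWeight, h2]
  linarith

lemma ellK_pos {K : ℕ} (hK : 1 ≤ K) : 0 < ellK K :=
  Finset.sum_pos (fun _ _ => by positivity) (Finset.nonempty_range_iff.2 (by omega))

lemma one_le_ellK {K : ℕ} (hK : 1 ≤ K) : 1 ≤ ellK K := by
  have h := Finset.single_le_sum (f := fun k : ℕ => ((k : ℝ) + 1)⁻¹) (s := Finset.range K)
    (fun _ _ => by positivity) (Finset.mem_range.2 hK)
  simpa [ellK] using h

lemma measurable_simesWeight (n : ℕ) (x : ℝ) : Measurable (simesWeight n x) := by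
  have h : ∀ y : ℝ, Measurable ((Iic y).indicator (1 : ℝ → ℝ)) :=
    fun y => measurable_one.indicator measurableSet_Iic
  exact (Finset.measurable_sum _ fun j _ => (h _).const_mul _).add ((h _).const_mul _)

lemma integrable_simesWeight (n : ℕ) (x : ℝ) : Integrable (simesWeight n x) unif01 := by
  have h : ∀ y : ℝ, Integrable ((Iic y).indicator (1 : ℝ → ℝ)) unif01 :=
    fun y => (integrable_const (1 : ℝ)).indicator measurableSet_Iic
  exact (integrable_finsetSum _ fun j _ => (h _).const_mul _).add ((h _).const_mul _)

lemma integral_simesWeight_le (n : ℕ) {x : ℝ} (hx : 0 ≤ x) :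
    ∫ p, simesWeight n x p ∂unif01 ≤ x * ellK (n + 1) / (n + 1) := by
  have h : ∀ y : ℝ, Integrable ((Iic y).indicator (1 : ℝ → ℝ)) unif01 :=
    fun y => (integrable_const (1 : ℝ)).indicator measurableSet_Iic
  unfold simesWeight
  rw [integral_add (integrable_finsetSum _ fun j _ => (h _).const_mul _) ((h _).const_mul _),
    integral_finsetSum _ fun j _ => (h _).const_mul _]
  simp only [integral_const_mul, integral_indicator_one measurableSet_Iic]
  calc _ ≤ ∑ j ∈ Finset.range n, ((1 : ℝ) / (j + 1) - 1 / (j + 2)) * ((j + 1) * x / (n + 1)) +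
        1 / (n + 1) * x := by
        gcongr with j
        · exact one_div_add_one_sub_nonneg j
        · exact unif01_real_Iic_le (by positivity)
        · exact unif01_real_Iic_le hx
    _ = x * ellK (n + 1) / (n + 1) := by
        rw [ellK, Finset.sum_range_succ', mul_add, add_div, Finset.mul_sum, Finset.sum_div]
        congr 1
        · refine Finset.sum_congr rfl fun j _ => ?_
          push_cast
          field_simp
          ring
        · simp
          ring

lemma measureReal_simes_le {Ω : Type*} [MeasurableSpace Ω] {P : MeasureTheory.Measure Ω}
    [IsProbabilityMeasure P] {K : ℕ} (hK : 1 ≤ K) {U : Fin K → Ω → ℝ} (hU : ∀ i, IsUnif P (U i))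
    {x : ℝ} (hx : 0 ≤ x) : P.real {ω | simes K (fun i => U i ω) ≤ x} ≤ x * ellK K := by
  obtain ⟨n, rfl⟩ : ∃ n, K = n + 1 := ⟨K - 1, by omega⟩
  have hm : MeasurableSet {ω | simes (n + 1) (fun i => U i ω) ≤ x} :=
    (measurable_pi_lambda (fun ω i => U i ω) fun i => (hU i).1) (measurableSet_simes_le hK x)
  have hint : ∀ i, Integrable (fun ω => simesWeight n x (U i ω)) P := by
    intro i
    have h : Integrable (simesWeight n x) (P.map (U i)) := by
      rw [(hU i).2]
      exact integrable_simesWeight n x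
    exact h.comp_measurable (hU i).1
  have hbound : ∀ ω, {ω | simes (n + 1) (fun i => U i ω) ≤ x}.indicator (1 : Ω → ℝ) ω ≤
      ∑ i, simesWeight n x (U i ω) := by
    intro ω
    refine indicator_apply_le' (fun hω => ?_)
      (fun _ => Finset.sum_nonneg fun i _ => simesWeight_nonneg n x _)
    obtain ⟨r, hr, hcard⟩ := (simes_le_iff hK _ _).1 hω
    obtain ⟨hr1, hr2⟩ := Finset.mem_Icc.1 hr
    obtain ⟨m, rfl⟩ : ∃ m, r = m + 1 := ⟨r - 1, by omega⟩
    have hcard' : (m : ℝ) + 1 ≤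
        (Finset.univ.filter fun i => U i ω ≤ (m + 1 : ℕ) * x / (n + 1 : ℕ)).card := by
      exact_mod_cast hcard
    calc (1 : ℝ) = (m + 1) * (1 / (m + 1)) := by field_simp
      _ ≤ (Finset.univ.filter fun i => U i ω ≤ (m + 1 : ℕ) * x / (n + 1 : ℕ)).card *
          (1 / (m + 1)) := by gcongr
      _ = ∑ i ∈ Finset.univ.filter fun i => U i ω ≤ (m + 1 : ℕ) * x / (n + 1 : ℕ),
          (1 / ((m : ℝ) + 1)) := by rw [Finset.sum_const, nsmul_eq_mul]
      _ ≤ ∑ i ∈ Finset.univ.filter fun i => U i ω ≤ (m + 1 : ℕ) * x / (n + 1 : ℕ),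
          simesWeight n x (U i ω) := by
        refine Finset.sum_le_sum fun i hi => one_div_le_simesWeight (by omega) hx ?_
        have := (Finset.mem_filter.1 hi).2
        push_cast at this
        exact this
      _ ≤ ∑ i, simesWeight n x (U i ω) :=
        Finset.sum_le_sum_of_subset_of_nonneg (Finset.filter_subset _ _)
          fun i _ _ => simesWeight_nonneg n x _
  have hUi : ∀ i, ∫ ω, simesWeight n x (U i ω) ∂P ≤ x * ellK (n + 1) / (n + 1) := by
    intro i
    rw [← integral_map (hU i).1.aemeasurable (measurable_simesWeight n x).aestronglyMeasurable,
      (hU i).2]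
    exact integral_simesWeight_le n hx
  calc P.real {ω | simes (n + 1) (fun i => U i ω) ≤ x}
      = ∫ ω, {ω | simes (n + 1) (fun i => U i ω) ≤ x}.indicator (1 : Ω → ℝ) ω ∂P :=
        (integral_indicator_one hm).symm
    _ ≤ ∫ ω, ∑ i, simesWeight n x (U i ω) ∂P :=
        integral_mono ((integrable_const (1 : ℝ)).indicator hm)
          (integrable_finsetSum _ fun i _ => hint i) hbound
    _ = ∑ i, ∫ ω, simesWeight n x (U i ω) ∂P := integral_finsetSum _ fun i _ => hint i
    _ ≤ ∑ _i : Fin (n + 1), x * ellK (n + 1) / (n + 1) := Finset.sum_le_sum fun i _ => hUi i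
    _ = x * ellK (n + 1) := by
        rw [Finset.sum_const, Finset.card_univ, Fintype.card_fin, nsmul_eq_mul]
        push_cast
        field_simp

lemma div_ellK_le_of_le_measureReal {Ω : Type*} [MeasurableSpace Ω] {P : MeasureTheory.Measure Ω}
    [IsProbabilityMeasure P] {K : ℕ} (hK : 1 ≤ K) {U : Fin K → Ω → ℝ} (hU : ∀ i, IsUnif P (U i))
    {ε y : ℝ} (hε : 0 < ε) (hy : ε ≤ P.real {ω | simes K (fun i => U i ω) ≤ y}) :
    ε / ellK K ≤ y := by
  rw [div_le_iff₀ (ellK_pos hK)]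
  rcases le_total 0 y with h0 | h0
  · exact hy.trans (measureReal_simes_le hK hU h0)
  · have h1 : P.real {ω | simes K (fun i => U i ω) ≤ y} ≤
        P.real {ω | simes K (fun i => U i ω) ≤ 0} :=
      measureReal_mono fun ω (hω : simes K (fun i => U i ω) ≤ y) => hω.trans h0
    have h2 := measureReal_simes_le hK hU le_rfl
    rw [zero_mul] at h2
    linarith

lemma div_ellK_le_lQuantile {Ω : Type*} [MeasurableSpace Ω] {P : MeasureTheory.Measure Ω}
    [IsProbabilityMeasure P] {K : ℕ} (hK : 1 ≤ K) {U : Fin K → Ω → ℝ} (hU : ∀ i, IsUnif P (U i))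
    {ε : ℝ} (hε : ε ∈ Ioo (0 : ℝ) 1) :
    ε / ellK K ≤ lQuantile P (fun ω => simes K (fun i => U i ω)) ε := by
  refine le_csInf ⟨1, ?_⟩ fun y hy => div_ellK_le_of_le_measureReal hK hU hε.1 hy
  have hae : ∀ᵐ ω ∂P, ∀ i, U i ω ≤ 1 := by
    refine ae_all_iff.2 fun i => ?_
    refine ae_of_ae_map (p := fun u => u ≤ 1) (hU i).1.aemeasurable ?_
    rw [(hU i).2, unif01]
    filter_upwards [ae_restrict_mem measurableSet_Icc] with u hu using hu.2
  have hS : ∀ᵐ ω ∂P, simes K (fun i => U i ω) ≤ 1 := by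
    filter_upwards [hae] with ω hω
    refine (simes_le_iff hK _ _).2 ⟨K, Finset.mem_Icc.2 ⟨hK, le_rfl⟩, ?_⟩
    have hK0 : (K : ℝ) ≠ 0 := by positivity
    simp [hK0, hω]
  have h1 : P {ω | simes K (fun i => U i ω) ≤ 1} = 1 := by
    rw [measure_congr (eventuallyEq_univ.2 hS), measure_univ]
  rw [mem_ofPred_eq, h1]
  exact hε.2.le

lemma tendsto_ellK_div_log :
    Tendsto (fun n : ℕ => ellK n / Real.log n) atTop (nhds 1) := by
  have hell : ∀ n, ellK n = harmonic n := by
    intro n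
    simp [ellK, harmonic]
  have hlog : Tendsto (fun n : ℕ => Real.log n) atTop atTop :=
    Real.tendsto_log_atTop.comp tendsto_natCast_atTop_atTop
  have h := (Real.tendsto_harmonic_sub_log.div_atTop hlog).add_const 1
  rw [zero_add] at h
  refine h.congr' ?_
  filter_upwards [hlog.eventually_ne_atTop 0] with n hn
  rw [hell]
  field_simp
  ring

lemma volume_real_Ioc_inter_add {a b c : ℝ} (hab : a ≤ b) (hbc : b ≤ c) {B : Set ℝ}
    (hB : MeasurableSet B) :
    volume.real (Ioc a c ∩ B) = volume.real (Ioc a b ∩ B) + volume.real (Ioc b c ∩ B) := by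
  have hfin : ∀ a b : ℝ, volume (Ioc a b ∩ B) ≠ ⊤ := fun a b =>
    ((measure_mono inter_subset_left).trans_lt measure_Ioc_lt_top).ne
  rw [← measureReal_union ((Ioc_disjoint_Ioc_of_le le_rfl).mono inter_subset_left
    inter_subset_left) (measurableSet_Ioc.inter hB) (hfin _ _) (hfin _ _),
    ← union_inter_distrib_right, Ioc_union_Ioc_eq_Ioc hab hbc]

lemma sum_volume_real_Ioc_inter {h : ℝ} (hh : 0 ≤ h) {B : Set ℝ} (hB : MeasurableSet B) (n : ℕ) :
    ∑ j ∈ Finset.range n, volume.real (Ioc (j * h) ((j + 1) * h) ∩ B) =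
      volume.real (Ioc 0 (n * h) ∩ B) := by
  induction n with
  | zero => simp
  | succ n ih =>
    rw [Finset.sum_range_succ, ih,
      ← volume_real_Ioc_inter_add (by positivity) (by gcongr; simp) hB]
    push_cast
    rfl

lemma volume_real_Ioc_inter_eq {a b : ℝ} (hab : a < b) (B : Set ℝ) :
    volume.real (Ioc a b ∩ B) = (b - a) * (volume[|Ioc a b]).real B := by
  have : b - a ≠ 0 := (sub_pos.2 hab).ne'
  simp only [measureReal_def, cond_apply measurableSet_Ioc, Real.volume_Ioc, ENNReal.toReal_mul,
    ENNReal.toReal_inv, ENNReal.toReal_ofReal (sub_pos.2 hab).le]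
  field_simp

lemma isProbabilityMeasure_cond_Ioc {a b : ℝ} (hab : a < b) :
    IsProbabilityMeasure (volume[|Ioc a b]) :=
  cond_isProbabilityMeasure_of_finite (by simp [hab]) measure_Ioc_lt_top.ne

lemma measureReal_finsetSum_smul {ι α : Type*} [MeasurableSpace α] (s : Finset ι) {c : ι → ℝ}
    (hc : ∀ i ∈ s, 0 ≤ c i) (ν : ι → MeasureTheory.Measure α) [∀ i, IsFiniteMeasure (ν i)]
    (A : Set α) :
    (∑ i ∈ s, ENNReal.ofReal (c i) • ν i).real A = ∑ i ∈ s, c i * (ν i).real A := by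
  rw [measureReal_def, Measure.finsetSum_apply, ENNReal.toReal_sum]
  · refine Finset.sum_congr rfl fun i hi => ?_
    rw [Measure.smul_apply, smul_eq_mul, ENNReal.toReal_mul, ENNReal.toReal_ofReal (hc i hi)]
    rfl
  · intro i _
    rw [Measure.smul_apply, smul_eq_mul]
    exact ENNReal.mul_ne_top ENNReal.ofReal_ne_top (measure_ne_top _ _)

lemma card_filter_add_le {n : ℕ} (i j : Fin (n + 1)) :
    (Finset.univ.filter fun k => i + k ≤ j).card = (j : ℕ) + 1 := by
  rw [← Fin.card_Iic]
  exact Finset.card_equiv (Equiv.addLeft i) (by simp)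

/-- The coordinates `i` with `i + k ≤ j` are uniform on the `j`-th of the `n + 1` cells
of `(0, x]`, the others are uniform on `(x, 1]`. -/
noncomputable def simesComponent (n : ℕ) (x : ℝ) (jk : Fin (n + 1) × Fin (n + 1))
    (i : Fin (n + 1)) : MeasureTheory.Measure ℝ :=
  if i + jk.2 ≤ jk.1 then
    volume[|Ioc ((jk.1 : ℕ) * (x / (n + 1))) (((jk.1 : ℕ) + 1) * (x / (n + 1)))]
  else volume[|Ioc x 1]

/-- Weights of the mixture; `none` stands for all coordinates uniform on `(x, 1]`. -/
noncomputable def simesMixtureWeight (n : ℕ) (x : ℝ) : Option (Fin (n + 1) × Fin (n + 1)) → ℝ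
  | none => 1 - x * ellK (n + 1)
  | some jk => x / (n + 1) / ((jk.1 : ℕ) + 1)

noncomputable def simesMixtureMarginal (n : ℕ) (x : ℝ) :
    Option (Fin (n + 1) × Fin (n + 1)) → Fin (n + 1) → MeasureTheory.Measure ℝ
  | none => fun _ => volume[|Ioc x 1]
  | some jk => simesComponent n x jk

/-- A law with uniform marginals for which the Simes function is at most `x` with the largest
possible probability `x * ellK (n + 1)`. -/
noncomputable def simesMixture (n : ℕ) (x : ℝ) : MeasureTheory.Measure (Fin (n + 1) → ℝ) :=
  ∑ a, ENNReal.ofReal (simesMixtureWeight n x a) • Measure.pi (simesMixtureMarginal n x a)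

section simesMixture

variable {n : ℕ} {x : ℝ}

lemma isProbabilityMeasure_simesMixtureMarginal (hx0 : 0 < x) (hx1 : x < 1)
    (a : Option (Fin (n + 1) × Fin (n + 1))) (i : Fin (n + 1)) :
    IsProbabilityMeasure (simesMixtureMarginal n x a i) := by
  have hh : 0 < x / (n + 1) := by positivity
  cases a with
  | none => exact isProbabilityMeasure_cond_Ioc hx1
  | some jk =>
    simp only [simesMixtureMarginal, simesComponent]
    split_ifs
    · exact isProbabilityMeasure_cond_Ioc (by gcongr; simp)
    · exact isProbabilityMeasure_cond_Ioc hx1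

lemma simesMixtureWeight_nonneg (hx0 : 0 < x) (hx : x * ellK (n + 1) ≤ 1)
    (a : Option (Fin (n + 1) × Fin (n + 1))) : 0 ≤ simesMixtureWeight n x a := by
  cases a with
  | none => exact sub_nonneg.2 hx
  | some jk =>
    simp only [simesMixtureWeight]
    positivity

lemma sum_simesMixtureWeight_some :
    ∑ jk, simesMixtureWeight n x (some jk) = x * ellK (n + 1) := by
  rw [Fintype.sum_prod_type, ellK, Finset.mul_sum, Finset.sum_range]
  refine Finset.sum_congr rfl fun j _ => ?_
  simp only [simesMixtureWeight, Finset.sum_const, Finset.card_univ, Fintype.card_fin, nsmul_eq_mul]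
  push_cast
  field_simp

lemma simesMixture_real (hx0 : 0 < x) (hx1 : x < 1) (hx : x * ellK (n + 1) ≤ 1)
    (A : Set (Fin (n + 1) → ℝ)) :
    (simesMixture n x).real A = ∑ a, simesMixtureWeight n x a *
      (Measure.pi (simesMixtureMarginal n x a)).real A := by
  have := isProbabilityMeasure_simesMixtureMarginal (n := n) hx0 hx1
  exact measureReal_finsetSum_smul _ (fun a _ => simesMixtureWeight_nonneg hx0 hx a) _ A

lemma isFiniteMeasure_simesMixture (hx0 : 0 < x) (hx1 : x < 1) :
    IsFiniteMeasure (simesMixture n x) := by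
  have := isProbabilityMeasure_simesMixtureMarginal (n := n) hx0 hx1
  have : ∀ a, IsFiniteMeasure
      (ENNReal.ofReal (simesMixtureWeight n x a) • Measure.pi (simesMixtureMarginal n x a)) :=
    fun a => Measure.smul_finite _ ENNReal.ofReal_ne_top
  unfold simesMixture
  infer_instance

lemma isProbabilityMeasure_simesMixture (hx0 : 0 < x) (hx1 : x < 1) (hx : x * ellK (n + 1) ≤ 1) :
    IsProbabilityMeasure (simesMixture n x) := by
  have := isProbabilityMeasure_simesMixtureMarginal (n := n) hx0 hx1
  have := isFiniteMeasure_simesMixture (n := n) hx0 hx1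
  have h : (simesMixture n x).real univ = 1 := by
    rw [simesMixture_real hx0 hx1 hx]
    simp only [probReal_univ, mul_one]
    rw [Fintype.sum_option, sum_simesMixtureWeight_some]
    simp [simesMixtureWeight]
  exact ⟨by rwa [measureReal_def, ENNReal.toReal_eq_one_iff] at h⟩

lemma simesMixture_map_eval (hx0 : 0 < x) (hx1 : x < 1) (hx : x * ellK (n + 1) ≤ 1)
    (i : Fin (n + 1)) : (simesMixture n x).map (fun p => p i) = unif01 := by
  have := isProbabilityMeasure_simesMixtureMarginal (n := n) hx0 hx1
  have := isProbabilityMeasure_simesMixture hx0 hx1 hx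
  have hi : Measurable fun p : Fin (n + 1) → ℝ => p i := measurable_pi_apply i
  have := Measure.isProbabilityMeasure_map (μ := simesMixture n x) hi.aemeasurable
  have hh : 0 < x / (n + 1) := by positivity
  refine Measure.ext fun B hB => ?_
  refine (measureReal_eq_measureReal_iff).1 ?_
  rw [map_measureReal_apply hi hB, simesMixture_real hx0 hx1 hx]
  have hpi : ∀ a, (Measure.pi (simesMixtureMarginal n x a)).real ((fun p => p i) ⁻¹' B) =
      (simesMixtureMarginal n x a i).real B := by
    intro a
    rw [measureReal_def, (measurePreserving_eval (simesMixtureMarginal n x a) i).measure_preimage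
      hB.nullMeasurableSet]
    rfl
  simp only [hpi]
  set β := (volume[|Ioc x 1]).real B with hβ
  have hrow : ∀ j : Fin (n + 1), ∑ k, simesMixtureWeight n x (some (j, k)) *
      (simesMixtureMarginal n x (some (j, k)) i).real B =
      volume.real (Ioc ((j : ℕ) * (x / (n + 1))) (((j : ℕ) + 1) * (x / (n + 1))) ∩ B) +
        (x / ((j : ℕ) + 1) - x / (n + 1)) * β := by
    intro j
    rw [volume_real_Ioc_inter_eq (by gcongr; simp)]
    set α := (volume[|Ioc ((j : ℕ) * (x / (n + 1))) (((j : ℕ) + 1) * (x / (n + 1)))]).real B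
      with hα
    have hterm : ∀ k, simesMixtureWeight n x (some (j, k)) *
        (simesMixtureMarginal n x (some (j, k)) i).real B =
        x / (n + 1) / ((j : ℕ) + 1) * ((if i + k ≤ j then 1 else 0) * (α - β) + β) := by
      intro k
      simp only [simesMixtureWeight, simesMixtureMarginal, simesComponent]
      split_ifs
      · rw [← hα]
        ring
      · rw [← hβ]
        ring
    simp only [hterm]
    rw [← Finset.mul_sum, Finset.sum_add_distrib, ← Finset.sum_mul, Finset.sum_boole,
      card_filter_add_le, Finset.sum_const, Finset.card_univ, Fintype.card_fin, nsmul_eq_mul]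
    push_cast
    field_simp
    ring
  have hell : ∑ j : Fin (n + 1), (x / ((j : ℕ) + 1) - x / (n + 1)) = x * ellK (n + 1) - x := by
    rw [Finset.sum_sub_distrib, ellK, Finset.mul_sum, Finset.sum_range, Finset.sum_const,
      Finset.card_univ, Fintype.card_fin, nsmul_eq_mul]
    push_cast
    congr 1
    field_simp
  have hcells : ∑ j : Fin (n + 1),
      volume.real (Ioc ((j : ℕ) * (x / (n + 1))) (((j : ℕ) + 1) * (x / (n + 1))) ∩ B) =
      volume.real (Ioc 0 x ∩ B) := by
    rw [← Finset.sum_range fun j : ℕ =>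
      volume.real (Ioc (j * (x / (n + 1))) ((j + 1) * (x / (n + 1))) ∩ B),
      sum_volume_real_Ioc_inter hh.le hB]
    congr 3
    push_cast
    field_simp
  have htotal : unif01.real B = volume.real (Ioc 0 x ∩ B) + volume.real (Ioc x 1 ∩ B) := by
    rw [← volume_real_Ioc_inter_add hx0.le hx1.le hB, unif01,
      Measure.restrict_congr_set Ioc_ae_eq_Icc.symm, measureReal_restrict_apply hB, inter_comm]
  rw [Fintype.sum_option, Fintype.sum_prod_type]
  simp only [hrow]
  rw [Finset.sum_add_distrib, hcells, ← Finset.sum_mul, hell, htotal,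
    volume_real_Ioc_inter_eq hx1, ← hβ]
  simp only [simesMixtureWeight, simesMixtureMarginal, ← hβ]
  ring

lemma pi_simesComponent_real_simes_le (hx0 : 0 < x) (hx1 : x < 1)
    (jk : Fin (n + 1) × Fin (n + 1)) :
    (Measure.pi (simesMixtureMarginal n x (some jk))).real {p | simes (n + 1) p ≤ x} = 1 := by
  have := isProbabilityMeasure_simesMixtureMarginal (n := n) hx0 hx1
  have hae : ∀ᵐ p ∂Measure.pi (simesMixtureMarginal n x (some jk)), ∀ i, i + jk.2 ≤ jk.1 →
      p i ≤ ((jk.1 : ℕ) + 1) * (x / (n + 1)) := by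
    refine ae_all_iff.2 fun i => ?_
    refine (measurePreserving_eval (simesMixtureMarginal n x (some jk)) i).quasiMeasurePreserving.ae
      (p := fun u => i + jk.2 ≤ jk.1 → u ≤ ((jk.1 : ℕ) + 1) * (x / (n + 1))) ?_
    simp only [simesMixtureMarginal, simesComponent]
    split_ifs with h
    · filter_upwards [ae_cond_mem measurableSet_Ioc] with u hu _ using hu.2
    · exact ae_of_all _ fun u h' => absurd h' h
  have hS : ∀ᵐ p ∂Measure.pi (simesMixtureMarginal n x (some jk)), simes (n + 1) p ≤ x := by
    filter_upwards [hae] with p hp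
    refine (simes_le_iff (by omega) _ _).2 ⟨jk.1 + 1, Finset.mem_Icc.2 ⟨by omega, jk.1.2⟩, ?_⟩
    refine (card_filter_add_le jk.2 jk.1).symm.trans_le (Finset.card_le_card fun i hi => ?_)
    simp only [Finset.mem_filter, Finset.mem_univ, true_and] at hi ⊢
    rw [add_comm jk.2 i] at hi
    refine (hp i hi).trans_eq ?_
    push_cast
    ring
  rw [measureReal_congr (eventuallyEq_univ.2 hS), probReal_univ]

lemma le_simesMixture_real_simes_le (hx0 : 0 < x) (hx1 : x < 1) (hx : x * ellK (n + 1) ≤ 1) :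
    x * ellK (n + 1) ≤ (simesMixture n x).real {p | simes (n + 1) p ≤ x} := by
  rw [simesMixture_real hx0 hx1 hx, Fintype.sum_option]
  simp only [pi_simesComponent_real_simes_le hx0 hx1, mul_one, sum_simesMixtureWeight_some]
  exact le_add_of_nonneg_left
    (mul_nonneg (simesMixtureWeight_nonneg hx0 hx none) measureReal_nonneg)

end simesMixture

lemma VAD_simes {Ω : Type*} [MeasurableSpace Ω] {P : MeasureTheory.Measure Ω}
    [IsProbabilityMeasure P] (hP : Atomless P) {K : ℕ} (hK : 1 ≤ K) {ε : ℝ}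
    (hε : ε ∈ Ioo (0 : ℝ) 1) : VAD P K (simes K) ε = ε / ellK K := by
  obtain ⟨n, rfl⟩ : ∃ n, K = n + 1 := ⟨K - 1, by omega⟩
  have hell := ellK_pos hK
  have hx0 : 0 < ε / ellK (n + 1) := div_pos hε.1 hell
  have hx1 : ε / ellK (n + 1) < 1 := (div_le_self hε.1.le (one_le_ellK hK)).trans_lt hε.2
  have hxε : ε / ellK (n + 1) * ellK (n + 1) = ε := div_mul_cancel₀ _ hell.ne'
  have hx : ε / ellK (n + 1) * ellK (n + 1) ≤ 1 := hxε.trans_le hε.2.le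
  have := isProbabilityMeasure_simesMixture hx0 hx1 hx
  obtain ⟨X, hX, hPX⟩ := hP.exists_map_eq (simesMixture n (ε / ellK (n + 1)))
  have hU : ∀ i, IsUnif P fun ω => X ω i := by
    intro i
    refine ⟨(measurable_pi_apply i).comp hX, ?_⟩
    rw [← simesMixture_map_eval hx0 hx1 hx i, ← hPX, Measure.map_map (measurable_pi_apply i) hX]
    rfl
  have hle : ε ≤ P.real {ω | simes (n + 1) (fun i => X ω i) ≤ ε / ellK (n + 1)} := by
    have h := le_simesMixture_real_simes_le hx0 hx1 hx
    rw [hxε, ← hPX, map_measureReal_apply hX (measurableSet_simes_le hK _)] at h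
    exact h
  refine IsLeast.csInf_eq ⟨⟨fun i ω => X ω i, hU, ?_⟩, ?_⟩
  · refine le_antisymm (div_ellK_le_lQuantile hK hU hε) (csInf_le ?_ hle)
    exact ⟨ε / ellK (n + 1), fun y hy => div_ellK_le_of_le_measureReal hK hU hε.1 hy⟩
  · rintro _ ⟨U, hU, rfl⟩
    exact div_ellK_le_lQuantile hK hU hε

/-- thresholds of the Simes function: `a_F(ε) = ε/ℓ_K`,
`b_F(ε) = c_F(ε) = ε`, hence `b_F/a_F = c_F/a_F = ℓ_K`; moreover
`ℓ_K / log K → 1` as `K → ∞`. -/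
theorem simes_thresholds
    {Ω : Type*} [MeasurableSpace Ω] (P : MeasureTheory.Measure Ω)
    [MeasureTheory.IsProbabilityMeasure P] (hP : Atomless P)
    (K : ℕ) (hK : 1 ≤ K) :
    (∀ ε ∈ Set.Ioo (0:ℝ) 1,
      VAD P K (simes K) ε = ε / ellK K ∧
      VI K (simes K) ε = ε ∧
      VC K (simes K) ε = ε ∧
      VI K (simes K) ε / VAD P K (simes K) ε = ellK K ∧
      VC K (simes K) ε / VAD P K (simes K) ε = ellK K) ∧
    Filter.Tendsto (fun n : ℕ => ellK n / Real.log n) Filter.atTop (nhds 1) := by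
  refine ⟨fun ε hε => ?_, tendsto_ellK_div_log⟩
  have hell := (ellK_pos hK).ne'
  have hε0 := hε.1.ne'
  rw [VAD_simes hP hK hε, VI_simes hK hε, VC_simes hK hε]
  exact ⟨rfl, rfl, rfl, by field_simp, by field_simp⟩
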